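/- Let $-1<\alpha<0$, $T>0$, and set $d_\alpha = 1/\cos(\alpha\pi/2)$. Then for all $v,w\in \mathcal C^0([0,T])$, $\int_0^T \mathcal I_{-\alpha} v(t)\, w(t)\,dt \;\le\; d_\alpha \left(\int_0^T v\,\mathcal I_{-\alpha} v\,dt\right)^{1/2} \left(\int_0^T w\,\mathcal I_{-\alpha} w\,dt\right)^{1/2}$. -/

import Mathlib

open Real intervalIntegral Set
open MeasureTheory

/-- The power `x ^ r` on the positive half-line, extended by zero. -/
noncomputable def truncRpow (r x : ℝ) : ℝ := if 0 < x then x ^ r else 0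

theorem truncRpow_of_pos {r x : ℝ} (hx : 0 < x) : truncRpow r x = x ^ r := if_pos hx

theorem truncRpow_of_nonpos {r x : ℝ} (hx : x ≤ 0) : truncRpow r x = 0 := if_neg hx.not_gt

theorem truncRpow_nonneg (r x : ℝ) : 0 ≤ truncRpow r x := by
  unfold truncRpow
  split_ifs with h
  · positivity
  · rfl

@[fun_prop]
theorem measurable_truncRpow (r : ℝ) : Measurable (truncRpow r) :=
  Measurable.ite measurableSet_Ioi (by fun_prop) measurable_const

theorem truncRpow_mul {r d : ℝ} (hd : 0 < d) (u : ℝ) :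
    truncRpow r (d * u) = d ^ r * truncRpow r u := by
  rcases lt_or_ge 0 u with hu | hu
  · rw [truncRpow_of_pos hu, truncRpow_of_pos (mul_pos hd hu), mul_rpow hd.le hu.le]
  · rw [truncRpow_of_nonpos hu, truncRpow_of_nonpos (mul_nonpos_of_nonneg_of_nonpos hd.le hu),
      mul_zero]

theorem integral_eq_mul_integral_comp_affine (f : ℝ → ℝ) (s : ℝ) {d : ℝ} (hd : 0 < d) :
    ∫ x, f x = d * ∫ u, f (s + d * u) := by
  rw [Measure.integral_comp_mul_left (fun y => f (s + y)) d, integral_add_left_eq_self f s,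
    abs_of_pos (inv_pos.2 hd), smul_eq_mul, mul_inv_cancel_left₀ hd.ne']

theorem integral_Ioo_rpow_mul_one_sub_rpow {a b : ℝ} (ha : 0 < a) (hb : 0 < b) :
    ∫ x in Ioo (0 : ℝ) 1, x ^ (a - 1) * (1 - x) ^ (b - 1) = ProbabilityTheory.beta a b := by
  have hB := ProbabilityTheory.beta_pos ha hb
  have h1 := ProbabilityTheory.lintegral_betaPDF_eq_one ha hb
  rw [ProbabilityTheory.lintegral_betaPDF] at h1
  have h2 : ∫ x in Ioo (0 : ℝ) 1,
      1 / ProbabilityTheory.beta a b * x ^ (a - 1) * (1 - x) ^ (b - 1) = 1 := by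
    rw [integral_eq_lintegral_of_nonneg_ae, h1, ENNReal.toReal_one]
    · filter_upwards [ae_restrict_mem measurableSet_Ioo] with x hx
      have := sub_pos.2 hx.2
      have := hx.1
      simp only [Pi.zero_apply]
      positivity
    · exact Measurable.aestronglyMeasurable (by fun_prop)
  simp_rw [mul_assoc] at h2
  rw [MeasureTheory.integral_const_mul] at h2
  field_simp at h2
  linarith

theorem integral_truncRpow_mul_truncRpow_one_sub {γ : ℝ} (hγ : 0 < γ) :
    ∫ u, truncRpow (γ - 1) u * truncRpow (γ - 1) (1 - u) = ProbabilityTheory.beta γ γ := by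
  rw [← integral_Ioo_rpow_mul_one_sub_rpow hγ hγ, ← MeasureTheory.integral_indicator measurableSet_Ioo]
  congr 1 with u
  by_cases h0 : 0 < u <;> by_cases h1 : u < 1 <;> simp [truncRpow, h0, h1]

theorem integral_truncRpow_mul_truncRpow_sub_one {γ : ℝ} (hγ : 0 < γ) (hγ' : γ < 1 / 2) :
    ∫ u, truncRpow (γ - 1) u * truncRpow (γ - 1) (u - 1) =
      ProbabilityTheory.beta (1 - 2 * γ) γ := by
  have himage : (fun y : ℝ => y⁻¹) '' Ioo 0 1 = Ioi 1 := by
    rw [Set.image_inv_eq_inv, Set.inv_Ioo_0_left one_pos, inv_one]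
  calc ∫ u, truncRpow (γ - 1) u * truncRpow (γ - 1) (u - 1)
      = ∫ u in Ioi (1 : ℝ), u ^ (γ - 1) * (u - 1) ^ (γ - 1) := by
        rw [← MeasureTheory.integral_indicator measurableSet_Ioi]
        congr 1 with u
        by_cases h1 : 1 < u
        · have h0 : 0 < u := by linarith
          simp [truncRpow, h0, h1]
        · simp [truncRpow, h1]
    _ = ∫ y in Ioo (0 : ℝ) 1, |-(y ^ 2)⁻¹| • (y⁻¹ ^ (γ - 1) * (y⁻¹ - 1) ^ (γ - 1)) := by
        rw [← himage]
        exact integral_image_eq_integral_abs_deriv_smul measurableSet_Ioo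
          (fun y hy => (hasDerivAt_inv hy.1.ne').hasDerivWithinAt) inv_injective.injOn _
    _ = ∫ y in Ioo (0 : ℝ) 1, y ^ (1 - 2 * γ - 1) * (1 - y) ^ (γ - 1) := by
        refine setIntegral_congr_fun measurableSet_Ioo fun y hy => ?_
        have hy0 := hy.1
        have hy1 := sub_pos.2 hy.2
        have e : y⁻¹ - 1 = y⁻¹ * (1 - y) := by field_simp
        have e2 : (y ^ 2)⁻¹ = y ^ (-2 : ℝ) := by
          rw [rpow_neg hy0.le, rpow_two]
        simp only [smul_eq_mul]
        rw [abs_neg, abs_of_pos (by positivity), e, mul_rpow (by positivity) hy1.le, e2,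
          inv_rpow hy0.le, ← rpow_neg hy0.le, ← mul_assoc, ← mul_assoc, ← rpow_add hy0,
          ← rpow_add hy0]
        ring_nf
    _ = _ := integral_Ioo_rpow_mul_one_sub_rpow (by linarith) hγ

theorem rpow_mul_rpow_mul_self {γ d : ℝ} (hd : 0 < d) :
    d * (d ^ (γ - 1) * d ^ (γ - 1)) = d ^ (2 * γ - 1) := by
  nth_rw 1 [← rpow_one d]
  rw [← rpow_add hd, ← rpow_add hd]
  ring_nf

theorem truncRpow_sub_mul_truncRpow_sub_eq_zero {r s t : ℝ} (h : t ≤ s) (x : ℝ) :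
    truncRpow r (x - s) * truncRpow r (t - x) = 0 := by
  rcases le_total x s with hx | hx
  · rw [truncRpow_of_nonpos (sub_nonpos.2 hx), zero_mul]
  · rw [truncRpow_of_nonpos (sub_nonpos.2 (h.trans hx)), mul_zero]

theorem integral_truncRpow_sub_mul_truncRpow_sub {γ : ℝ} (hγ : 0 < γ) (s t : ℝ) :
    ∫ x, truncRpow (γ - 1) (x - s) * truncRpow (γ - 1) (t - x) =
      ProbabilityTheory.beta γ γ * truncRpow (2 * γ - 1) (t - s) := by
  rcases lt_or_ge s t with h | h
  · have hd := sub_pos.2 h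
    rw [integral_eq_mul_integral_comp_affine _ s hd, truncRpow_of_pos hd,
      ← integral_truncRpow_mul_truncRpow_one_sub hγ, ← rpow_mul_rpow_mul_self hd,
      ← MeasureTheory.integral_const_mul, ← MeasureTheory.integral_mul_const]
    congr 1 with u
    rw [show s + (t - s) * u - s = (t - s) * u by ring,
      show t - (s + (t - s) * u) = (t - s) * (1 - u) by ring, truncRpow_mul hd, truncRpow_mul hd]
    ring
  · rw [truncRpow_of_nonpos (by linarith), mul_zero]
    simp [truncRpow_sub_mul_truncRpow_sub_eq_zero h]

theorem integral_truncRpow_sub_mul_truncRpow_sub_left {γ : ℝ} (hγ : 0 < γ) (hγ' : γ < 1 / 2)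
    {s t : ℝ} (hst : s ≠ t) :
    ∫ x, truncRpow (γ - 1) (x - s) * truncRpow (γ - 1) (x - t) =
      ProbabilityTheory.beta (1 - 2 * γ) γ *
        (truncRpow (2 * γ - 1) (t - s) + truncRpow (2 * γ - 1) (s - t)) := by
  wlog h : s < t generalizing s t
  · rw [add_comm, ← this hst.symm (lt_of_le_of_ne (not_lt.1 h) hst.symm)]
    simp_rw [mul_comm]
  have hd := sub_pos.2 h
  rw [integral_eq_mul_integral_comp_affine _ s hd, truncRpow_of_pos hd,
    truncRpow_of_nonpos (by linarith : s - t ≤ 0), add_zero,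
    ← integral_truncRpow_mul_truncRpow_sub_one hγ hγ', ← rpow_mul_rpow_mul_self hd,
    ← MeasureTheory.integral_const_mul, ← MeasureTheory.integral_mul_const]
  congr 1 with u
  rw [show s + (t - s) * u - s = (t - s) * u by ring,
    show s + (t - s) * u - t = (t - s) * (u - 1) by ring, truncRpow_mul hd, truncRpow_mul hd]
  ring

theorem integral_truncRpow_sub_mul_truncRpow_sub_right {γ : ℝ} (hγ : 0 < γ) (hγ' : γ < 1 / 2)
    {s t : ℝ} (hst : s ≠ t) :
    ∫ x, truncRpow (γ - 1) (s - x) * truncRpow (γ - 1) (t - x) =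
      ProbabilityTheory.beta (1 - 2 * γ) γ *
        (truncRpow (2 * γ - 1) (t - s) + truncRpow (2 * γ - 1) (s - t)) := by
  rw [← integral_truncRpow_sub_mul_truncRpow_sub_left hγ hγ' hst,
    ← integral_sub_left_eq_self _ volume (s + t)]
  congr 1 with x
  rw [show s - (s + t - x) = x - t by ring, show t - (s + t - x) = x - s by ring, mul_comm]

theorem integrable_truncRpow_sub_mul_truncRpow_sub {γ : ℝ} (hγ : 0 < γ) (s t : ℝ) :
    Integrable fun x => truncRpow (γ - 1) (x - s) * truncRpow (γ - 1) (t - x) := by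
  rcases lt_or_ge s t with h | h
  · refine Integrable.of_integral_ne_zero ?_
    rw [integral_truncRpow_sub_mul_truncRpow_sub hγ, truncRpow_of_pos (sub_pos.2 h)]
    have := ProbabilityTheory.beta_pos hγ hγ
    have := sub_pos.2 h
    positivity
  · simp [truncRpow_sub_mul_truncRpow_sub_eq_zero h]

theorem beta_mul_truncRpow_add_truncRpow_ne_zero {γ : ℝ} (hγ : 0 < γ) (hγ' : γ < 1 / 2)
    {s t : ℝ} (hst : s ≠ t) :
    ProbabilityTheory.beta (1 - 2 * γ) γ *
      (truncRpow (2 * γ - 1) (t - s) + truncRpow (2 * γ - 1) (s - t)) ≠ 0 := by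
  refine mul_ne_zero (ProbabilityTheory.beta_pos (by linarith) hγ).ne' (ne_of_gt ?_)
  rcases lt_or_gt_of_ne hst with h | h
  · refine add_pos_of_pos_of_nonneg ?_ (truncRpow_nonneg _ _)
    rw [truncRpow_of_pos (sub_pos.2 h)]
    exact rpow_pos_of_pos (sub_pos.2 h) _
  · refine add_pos_of_nonneg_of_pos (truncRpow_nonneg _ _) ?_
    rw [truncRpow_of_pos (sub_pos.2 h)]
    exact rpow_pos_of_pos (sub_pos.2 h) _

theorem beta_div_beta_eq {γ : ℝ} (hγ : 0 < γ) (hγ' : γ < 1 / 2) :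
    2 * ProbabilityTheory.beta (1 - 2 * γ) γ / ProbabilityTheory.beta γ γ = 1 / cos (π * γ) := by
  have h1 := Real.Gamma_mul_Gamma_one_sub γ
  have h2 := Real.Gamma_mul_Gamma_one_sub (2 * γ)
  have hs : 0 < sin (π * γ) := sin_pos_of_pos_of_lt_pi (by positivity) (by nlinarith [pi_pos])
  have hc : 0 < cos (π * γ) :=
    cos_pos_of_mem_Ioo ⟨by nlinarith [pi_pos], by nlinarith [pi_pos]⟩
  rw [show π * (2 * γ) = 2 * (π * γ) by ring, sin_two_mul] at h2
  have g1 := Gamma_pos_of_pos hγ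
  have g2 := Gamma_pos_of_pos (show 0 < 2 * γ by linarith)
  have g3 := Gamma_pos_of_pos (show 0 < 1 - γ by linarith)
  have g4 := Gamma_pos_of_pos (show 0 < 1 - 2 * γ by linarith)
  unfold ProbabilityTheory.beta
  rw [show 1 - 2 * γ + γ = 1 - γ by ring, show γ + γ = 2 * γ by ring]
  rw [eq_div_iff (by positivity)] at h1 h2
  generalize sin (π * γ) = S at *
  generalize cos (π * γ) = C at *
  field_simp
  refine mul_right_cancel₀ hs.ne' ?_
  linarith

theorem integrable_and_integral_mul_eq_integral_prod {μ : Measure ℝ} [SFinite μ]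
    {p q : ℝ → ℝ → ℝ} {K : ℝ × ℝ → ℝ} {v w : ℝ → ℝ} {C D : ℝ}
    (hp : Measurable (Function.uncurry p)) (hq : Measurable (Function.uncurry q))
    (hp0 : ∀ x s, 0 ≤ p x s) (hq0 : ∀ x s, 0 ≤ q x s)
    (hpq : ∀ᵐ z ∂μ.prod μ, Integrable fun x => p x z.1 * q x z.2)
    (hpqK : ∀ᵐ z ∂μ.prod μ, ∫ x, p x z.1 * q x z.2 = K z) (hK : Integrable K (μ.prod μ))
    (hv : AEStronglyMeasurable v μ) (hw : AEStronglyMeasurable w μ)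
    (hvC : ∀ᵐ s ∂μ, ‖v s‖ ≤ C) (hwD : ∀ᵐ s ∂μ, ‖w s‖ ≤ D) :
    Integrable (fun x => (∫ s, p x s * v s ∂μ) * ∫ t, q x t * w t ∂μ) ∧
      ∫ x, (∫ s, p x s * v s ∂μ) * ∫ t, q x t * w t ∂μ =
        ∫ z, K z * (v z.1 * w z.2) ∂μ.prod μ := by
  have hP : Integrable (fun y : (ℝ × ℝ) × ℝ => p y.2 y.1.1 * q y.2 y.1.2)
      ((μ.prod μ).prod volume) := by
    have hm : Measurable fun y : (ℝ × ℝ) × ℝ => p y.2 y.1.1 * q y.2 y.1.2 :=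
      (hp.comp (by fun_prop : Measurable fun y : (ℝ × ℝ) × ℝ => (y.2, y.1.1))).mul
        (hq.comp (by fun_prop : Measurable fun y : (ℝ × ℝ) × ℝ => (y.2, y.1.2)))
    refine (integrable_prod_iff hm.aestronglyMeasurable).2 ⟨hpq, hK.congr ?_⟩
    filter_upwards [hpqK] with z hz
    simp_rw [Real.norm_of_nonneg (mul_nonneg (hp0 _ _) (hq0 _ _)), hz]
  have hvw : AEStronglyMeasurable (fun z : ℝ × ℝ => v z.1 * w z.2) (μ.prod μ) :=
    hv.comp_fst.mul hw.comp_snd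
  have hvw_bound : ∀ᵐ z ∂μ.prod μ, ‖v z.1 * w z.2‖ ≤ C * D := by
    filter_upwards [Measure.quasiMeasurePreserving_fst.ae hvC,
      Measure.quasiMeasurePreserving_snd.ae hwD] with z h1 h2
    rw [norm_mul]
    exact mul_le_mul h1 h2 (norm_nonneg _) ((norm_nonneg _).trans h1)
  have hF : Integrable
      (fun y : (ℝ × ℝ) × ℝ => p y.2 y.1.1 * q y.2 y.1.2 * (v y.1.1 * w y.1.2))
      ((μ.prod μ).prod volume) :=
    hP.mul_bdd (c := C * D) hvw.comp_fst (Measure.quasiMeasurePreserving_fst.ae hvw_bound)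
  have hslice : ∀ x, ∫ z, p x z.1 * q x z.2 * (v z.1 * w z.2) ∂μ.prod μ =
      (∫ s, p x s * v s ∂μ) * ∫ t, q x t * w t ∂μ := fun x => by
    rw [← integral_prod_mul]
    congr 1 with z
    ring
  constructor
  · simpa only [hslice] using hF.integral_prod_right
  · simp_rw [← hslice]
    rw [← integral_prod_symm _ hF, integral_prod _ hF]
    refine integral_congr_ae ?_
    filter_upwards [hpqK] with z hz
    rw [MeasureTheory.integral_mul_const, hz]

theorem integral_mul_le_sqrt_mul_sqrt {X : Type*} [MeasurableSpace X] {μ : Measure X}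
    {f g : X → ℝ} (hf : Integrable (fun x => f x * f x) μ) (hg : Integrable (fun x => g x * g x) μ)
    (hfg : Integrable (fun x => f x * g x) μ) :
    ∫ x, f x * g x ∂μ ≤ √(∫ x, f x * f x ∂μ) * √(∫ x, g x * g x ∂μ) := by
  have hf0 : 0 ≤ ∫ x, f x * f x ∂μ := integral_nonneg fun x => mul_self_nonneg _
  have h := discrim_le_zero (a := ∫ x, f x * f x ∂μ) (b := 2 * ∫ x, f x * g x ∂μ)
    (c := ∫ x, g x * g x ∂μ) fun l => by
      have : 0 ≤ ∫ x, (l * f x + g x) * (l * f x + g x) ∂μ :=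
        integral_nonneg fun x => mul_self_nonneg _
      have e : ∀ x, (l * f x + g x) * (l * f x + g x) =
          f x * f x * (l * l) + f x * g x * (2 * l) + g x * g x := fun x => by ring
      simp_rw [e] at this
      have h2 : Integrable (fun x => f x * f x * (l * l) + f x * g x * (2 * l)) μ :=
        (hf.mul_const _).add (hfg.mul_const _)
      rw [MeasureTheory.integral_add h2 hg, MeasureTheory.integral_add (hf.mul_const _) (hfg.mul_const _),
        MeasureTheory.integral_mul_const, MeasureTheory.integral_mul_const] at this
      linarith
  rw [discrim] at h
  rw [← sqrt_mul hf0]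
  exact le_sqrt_of_sq_le (by nlinarith)

theorem integrable_truncRpow_sub_prod {r : ℝ} (hr : -1 < r) (T : ℝ) :
    Integrable (fun z : ℝ × ℝ => truncRpow r (z.2 - z.1))
      ((volume.restrict (Ioc 0 T)).prod (volume.restrict (Ioc 0 T))) := by
  have hf : Integrable ((Ioc 0 T).indicator fun _ : ℝ => (1 : ℝ)) :=
    (integrable_indicator_iff measurableSet_Ioc).2 (by simp)
  have hg : Integrable ((Ioc 0 T).indicator fun x : ℝ => x ^ r) := by
    rw [integrable_indicator_iff measurableSet_Ioc]
    exact (intervalIntegral.intervalIntegrable_rpow' hr).1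
  have h := (hf.convolution_integrand (ContinuousLinearMap.mul ℝ ℝ) hg).swap
  rw [Measure.prod_restrict]
  refine (h.integrableOn (s := Ioc 0 T ×ˢ Ioc 0 T)).congr_fun (fun z hz => ?_)
    (measurableSet_Ioc.prod measurableSet_Ioc)
  obtain ⟨h1, h2⟩ := hz
  by_cases h0 : z.1 < z.2
  · have : z.2 - z.1 ∈ Ioc 0 T := ⟨sub_pos.2 h0, by linarith [h1.1, h2.2]⟩
    simp [h1, this, truncRpow_of_pos this.1]
  · have : z.2 - z.1 ∉ Ioc 0 T := fun h => h0 (sub_pos.1 h.1)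
    simp [this, truncRpow_of_nonpos (sub_nonpos.2 (not_lt.1 h0))]

theorem ae_fst_ne_snd (μ : Measure ℝ) [SFinite μ] [NullSingletonClass μ] :
    ∀ᵐ z ∂μ.prod μ, z.1 ≠ z.2 := by
  refine (Measure.ae_prod_iff_ae_ae (p := fun z : ℝ × ℝ => z.1 ≠ z.2) ?_).2 ?_
  · exact (measurableSet_eq_fun measurable_fst measurable_snd).compl
  · exact .of_forall fun x => (Measure.ae_ne μ x).mono fun y hy => hy.symm

/-- The bilinear form with kernel `(t - s) ^ r` on `0 < s < t ≤ T`. -/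
noncomputable def truncRpowForm (r T : ℝ) (v w : ℝ → ℝ) : ℝ :=
  ∫ z : ℝ × ℝ, truncRpow r (z.2 - z.1) * (v z.1 * w z.2)
    ∂(volume.restrict (Ioc 0 T)).prod (volume.restrict (Ioc 0 T))

theorem integral_symmetrized_truncRpow {r T : ℝ} {v : ℝ → ℝ}
    (h : Integrable (fun z : ℝ × ℝ => truncRpow r (z.2 - z.1) * (v z.1 * v z.2))
      ((volume.restrict (Ioc 0 T)).prod (volume.restrict (Ioc 0 T)))) (c : ℝ) :
    ∫ z : ℝ × ℝ, c * (truncRpow r (z.2 - z.1) + truncRpow r (z.1 - z.2)) * (v z.1 * v z.2)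
        ∂(volume.restrict (Ioc 0 T)).prod (volume.restrict (Ioc 0 T)) =
      2 * c * truncRpowForm r T v v := by
  have e : ∀ z : ℝ × ℝ,
      c * (truncRpow r (z.2 - z.1) + truncRpow r (z.1 - z.2)) * (v z.1 * v z.2) =
        c * (truncRpow r (z.2 - z.1) * (v z.1 * v z.2) +
          truncRpow r (z.swap.2 - z.swap.1) * (v z.swap.1 * v z.swap.2)) := fun z => by
    simp only [Prod.fst_swap, Prod.snd_swap]
    ring
  simp_rw [e, truncRpowForm]
  rw [MeasureTheory.integral_const_mul, MeasureTheory.integral_add h (by exact h.swap),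
    integral_prod_swap (fun z : ℝ × ℝ => truncRpow r (z.2 - z.1) * (v z.1 * v z.2))]
  ring

theorem integrable_truncRpow_sub_mul {r T C D : ℝ} (hr : -1 < r) {v w : ℝ → ℝ}
    (hv : AEStronglyMeasurable v (volume.restrict (Ioc 0 T)))
    (hw : AEStronglyMeasurable w (volume.restrict (Ioc 0 T)))
    (hvC : ∀ᵐ s ∂volume.restrict (Ioc 0 T), ‖v s‖ ≤ C)
    (hwD : ∀ᵐ s ∂volume.restrict (Ioc 0 T), ‖w s‖ ≤ D) :
    Integrable (fun z : ℝ × ℝ => truncRpow r (z.2 - z.1) * (v z.1 * w z.2))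
      ((volume.restrict (Ioc 0 T)).prod (volume.restrict (Ioc 0 T))) := by
  refine (integrable_truncRpow_sub_prod hr T).mul_bdd (c := C * D)
    (hv.comp_fst.mul hw.comp_snd) ?_
  filter_upwards [Measure.quasiMeasurePreserving_fst.ae hvC,
    Measure.quasiMeasurePreserving_snd.ae hwD] with z h1 h2
  rw [norm_mul]
  exact mul_le_mul h1 h2 (norm_nonneg _) ((norm_nonneg _).trans h1)

theorem truncRpowForm_le {γ T C D : ℝ} (hγ : 0 < γ) (hγ' : γ < 1 / 2) {v w : ℝ → ℝ}
    (hv : AEStronglyMeasurable v (volume.restrict (Ioc 0 T)))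
    (hw : AEStronglyMeasurable w (volume.restrict (Ioc 0 T)))
    (hvC : ∀ᵐ s ∂volume.restrict (Ioc 0 T), ‖v s‖ ≤ C)
    (hwD : ∀ᵐ s ∂volume.restrict (Ioc 0 T), ‖w s‖ ≤ D) :
    truncRpowForm (2 * γ - 1) T v w ≤
      1 / cos (π * γ) * √(truncRpowForm (2 * γ - 1) T v v) *
        √(truncRpowForm (2 * γ - 1) T w w) := by
  have hr : -1 < 2 * γ - 1 := by linarith
  have hp : Measurable (Function.uncurry fun x s : ℝ => truncRpow (γ - 1) (x - s)) :=
    (measurable_truncRpow _).comp (by fun_prop : Measurable fun z : ℝ × ℝ => z.1 - z.2)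
  have hq : Measurable (Function.uncurry fun x s : ℝ => truncRpow (γ - 1) (s - x)) :=
    (measurable_truncRpow _).comp (by fun_prop : Measurable fun z : ℝ × ℝ => z.2 - z.1)
  have h0 : ∀ y, 0 ≤ truncRpow (γ - 1) y := truncRpow_nonneg _
  have hne := ae_fst_ne_snd (volume.restrict (Ioc 0 T))
  have hK := integrable_truncRpow_sub_prod hr T
  have hKsymm := (hK.add (by exact hK.swap)).const_mul (ProbabilityTheory.beta (1 - 2 * γ) γ)
  obtain ⟨ivw, evw⟩ := integrable_and_integral_mul_eq_integral_prod hp hq (fun _ _ => h0 _)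
    (fun _ _ => h0 _) (.of_forall fun z => integrable_truncRpow_sub_mul_truncRpow_sub hγ z.1 z.2)
    (.of_forall fun z => integral_truncRpow_sub_mul_truncRpow_sub hγ z.1 z.2)
    (hK.const_mul (ProbabilityTheory.beta γ γ)) hv hw hvC hwD
  obtain ⟨ivv, evv⟩ := integrable_and_integral_mul_eq_integral_prod hp hp (fun _ _ => h0 _)
    (fun _ _ => h0 _)
    (hne.mono fun z hz => Integrable.of_integral_ne_zero <| by
      rw [integral_truncRpow_sub_mul_truncRpow_sub_left hγ hγ' hz]
      exact beta_mul_truncRpow_add_truncRpow_ne_zero hγ hγ' hz)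
    (hne.mono fun z hz => integral_truncRpow_sub_mul_truncRpow_sub_left hγ hγ' hz)
    hKsymm hv hv hvC hvC
  obtain ⟨iww, eww⟩ := integrable_and_integral_mul_eq_integral_prod hq hq (fun _ _ => h0 _)
    (fun _ _ => h0 _)
    (hne.mono fun z hz => Integrable.of_integral_ne_zero <| by
      rw [integral_truncRpow_sub_mul_truncRpow_sub_right hγ hγ' hz]
      exact beta_mul_truncRpow_add_truncRpow_ne_zero hγ hγ' hz)
    (hne.mono fun z hz => integral_truncRpow_sub_mul_truncRpow_sub_right hγ hγ' hz)
    hKsymm hw hw hwD hwD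
  have hCS := integral_mul_le_sqrt_mul_sqrt ivv iww ivw
  simp_rw [mul_assoc (ProbabilityTheory.beta γ γ)] at evw
  have hB := ProbabilityTheory.beta_pos hγ hγ
  have hB' := ProbabilityTheory.beta_pos (show 0 < 1 - 2 * γ by linarith) hγ
  have h2B : 0 ≤ 2 * ProbabilityTheory.beta (1 - 2 * γ) γ := by positivity
  rw [MeasureTheory.integral_const_mul, ← truncRpowForm] at evw
  rw [evw, evv, eww,
    integral_symmetrized_truncRpow (integrable_truncRpow_sub_mul hr hv hv hvC hvC),
    integral_symmetrized_truncRpow (integrable_truncRpow_sub_mul hr hw hw hwD hwD),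
    sqrt_mul h2B, sqrt_mul h2B, mul_mul_mul_comm, mul_self_sqrt h2B] at hCS
  rw [← beta_div_beta_eq hγ hγ', mul_assoc, div_mul_eq_mul_div, le_div_iff₀ hB, mul_comm]
  exact hCS

theorem integral_fractionalIntegral_mul_eq {r c T : ℝ} (hr : r ≠ 0) {v w : ℝ → ℝ}
    (hT : 0 ≤ T)
    (h : Integrable (fun z : ℝ × ℝ => truncRpow r (z.2 - z.1) * (v z.1 * w z.2))
      ((volume.restrict (Ioc 0 T)).prod (volume.restrict (Ioc 0 T)))) :
    ∫ t in (0 : ℝ)..T, (∫ s in (0 : ℝ)..t, (t - s) ^ r / c * v s) * w t =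
      truncRpowForm r T v w / c := by
  rw [truncRpowForm, integral_prod_symm _ h, intervalIntegral.integral_of_le hT,
    ← MeasureTheory.integral_div]
  refine setIntegral_congr_fun measurableSet_Ioc fun t ht => ?_
  simp only
  rw [intervalIntegral.integral_of_le ht.1.le, ← MeasureTheory.integral_mul_const,
    ← MeasureTheory.integral_div,
    ← MeasureTheory.integral_indicator measurableSet_Ioc, ← MeasureTheory.integral_indicator measurableSet_Ioc]
  congr 1 with s
  by_cases h0 : 0 < s
  · rcases lt_trichotomy s t with hst | rfl | hst
    · have : s ≤ T := hst.le.trans ht.2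
      simp only [h0, hst.le, this, mem_Ioc, and_self, indicator_of_mem,
        truncRpow_of_pos (sub_pos.2 hst)]
      ring
    · simp [indicator, truncRpow, zero_rpow hr]
    · simp [indicator, truncRpow, hst.not_ge, hst.not_gt]
  · simp [indicator, h0]



/-- For `-1 < α < 0`, `T > 0`, `d_α = 1/cos(απ/2)` and all continuous `v, w` on `[0,T]`,
`∫₀ᵀ (𝓘_{-α} v) w ≤ d_α (∫₀ᵀ v 𝓘_{-α} v)^{1/2} (∫₀ᵀ w 𝓘_{-α} w)^{1/2}`. -/
theorem stmt_10 (α T : ℝ) (hα₁ : -1 < α) (hα₂ : α < 0) (hT : 0 < T)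
    (v w : ℝ → ℝ)
    (hv : ContinuousOn v (Set.Icc 0 T)) (hw : ContinuousOn w (Set.Icc 0 T)) :
    ∫ t in (0:ℝ)..T,
        (∫ s in (0:ℝ)..t, ((t - s) ^ (-α - 1) / Real.Gamma (-α)) * v s) * w t
      ≤ (1 / Real.cos (α * Real.pi / 2)) *
          Real.sqrt (∫ t in (0:ℝ)..T,
            v t * ∫ s in (0:ℝ)..t, ((t - s) ^ (-α - 1) / Real.Gamma (-α)) * v s) *
          Real.sqrt (∫ t in (0:ℝ)..T,
            w t * ∫ s in (0:ℝ)..t, ((t - s) ^ (-α - 1) / Real.Gamma (-α)) * w s) := by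
  have hr : -1 < -α - 1 := by linarith
  have hr0 : -α - 1 ≠ 0 := by linarith
  have hΓ := Real.Gamma_pos_of_pos (neg_pos.2 hα₂)
  have hmeas : ∀ {u : ℝ → ℝ}, ContinuousOn u (Icc 0 T) →
      AEStronglyMeasurable u (volume.restrict (Ioc 0 T)) := fun hu =>
    (hu.mono Ioc_subset_Icc_self).aestronglyMeasurable measurableSet_Ioc
  have hbdd : ∀ {u : ℝ → ℝ}, ContinuousOn u (Icc 0 T) →
      ∃ C, ∀ᵐ s ∂volume.restrict (Ioc 0 T), ‖u s‖ ≤ C := fun hu => by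
    obtain ⟨C, hC⟩ := isCompact_Icc.exists_bound_of_continuousOn hu
    exact ⟨C, (ae_restrict_mem measurableSet_Ioc).mono fun s hs => hC s (Ioc_subset_Icc_self hs)⟩
  obtain ⟨C, hC⟩ := hbdd hv
  obtain ⟨D, hD⟩ := hbdd hw
  simp_rw [mul_comm (v _) (∫ s in (0 : ℝ).._, _), mul_comm (w _) (∫ s in (0 : ℝ).._, _)]
  rw [integral_fractionalIntegral_mul_eq hr0 hT.le
      (integrable_truncRpow_sub_mul hr (hmeas hv) (hmeas hw) hC hD),
    integral_fractionalIntegral_mul_eq hr0 hT.le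
      (integrable_truncRpow_sub_mul hr (hmeas hv) (hmeas hv) hC hC),
    integral_fractionalIntegral_mul_eq hr0 hT.le
      (integrable_truncRpow_sub_mul hr (hmeas hw) (hmeas hw) hD hD)]
  have h := truncRpowForm_le (γ := -α / 2) (by linarith) (by linarith) (hmeas hv) (hmeas hw) hC hD
  rw [show 2 * (-α / 2) - 1 = -α - 1 by ring, show π * (-α / 2) = -(α * π / 2) by ring,
    cos_neg] at h
  rw [sqrt_div' _ hΓ.le, sqrt_div' _ hΓ.le, mul_assoc, div_mul_div_comm, mul_self_sqrt hΓ.le,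
    ← mul_div_assoc, ← mul_assoc]
  gcongr
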